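/- arXiv:2408.15456 — 2 statements merged into one kernel-verified Lean document; each statement's English description precedes it below -/
import Mathlib

section
/- Let m, n, κ be positive integers with κ ≥ m and κ ≥ n, and let K₁ ∈ ℝ^{κ×n}, K₂ ∈ ℝ^{m×κ}, G ∈ ℝ^{m×n}. Then the following are equivalent: (1) K₂ᵀ·G = 0 and G·K₁ᵀ = 0; (2) there exist orthogonal matrices Ψ ∈ O(m), Φ ∈ O(n), Γ₁ ∈ O(κ), Γ₂ ∈ O(κ) and rectangular diagonal matrices with nonnegative diagonal entries Σ ∈ ℝ^{m×n}, Σ₁ ∈ ℝ^{κ×n}, Σ₂ ∈ ℝ^{m×κ} such that G = Ψ·Σ·Φᵀ, K₁ = Γ₁·Σ₁·Φᵀ, and K₂ = Ψ·Σ₂·Γ₂ᵀ are singular value decompositions, and Σ·Σ₁ᵀ = 0 and Σ₂ᵀ·Σ = 0. -/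
open Matrix

/-- A rectangular diagonal matrix: all entries off the main diagonal vanish. -/
def Matrix.IsRectDiagonal {p o : ℕ} (M : Matrix (Fin p) (Fin o) ℝ) : Prop :=
  ∀ (i : Fin p) (j : Fin o), (i : ℕ) ≠ (j : ℕ) → M i j = 0

theorem Matrix.apply_eq_zero_of_gram_diagonal {a b : ℕ} {M : Matrix (Fin a) (Fin b) ℝ}
    {d : Fin b → ℝ} (h : Mᵀ * M = diagonal d) {j : Fin b} (hj : d j = 0) (i : Fin a) :
    M i j = 0 := by
  have h1 := congrFun (congrFun h j) j
  rw [diagonal_apply_eq, hj] at h1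
  exact congrFun (dotProduct_self_eq_zero.1
    (show (fun i => M i j) ⬝ᵥ (fun i => M i j) = 0 from h1)) i

theorem Matrix.gram_apply_self_nonneg {a b : ℕ} (M : Matrix (Fin a) (Fin b) ℝ) (j : Fin b) :
    0 ≤ (Mᵀ * M) j j := by
  rw [mul_apply]
  exact Finset.sum_nonneg fun i _ => mul_self_nonneg (M i j)

theorem Matrix.nonneg_of_gram_diagonal {a b : ℕ} {M : Matrix (Fin a) (Fin b) ℝ}
    {d : Fin b → ℝ} (h : Mᵀ * M = diagonal d) (j : Fin b) : 0 ≤ d j := by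
  have h1 := congrFun (congrFun h j) j
  rw [diagonal_apply_eq] at h1
  rw [← h1]
  exact gram_apply_self_nonneg M j

/-- If the columns of `M` are pairwise orthogonal, then `M` is an orthogonal matrix times a
nonnegative rectangular diagonal matrix. -/
theorem Matrix.exists_orthogonal_mul_rectDiagonal {a b : ℕ} (hba : b ≤ a)
    {M : Matrix (Fin a) (Fin b) ℝ} {d : Fin b → ℝ} (h : Mᵀ * M = diagonal d) :
    ∃ (Q : Matrix (Fin a) (Fin a) ℝ) (S : Matrix (Fin a) (Fin b) ℝ),
      Qᵀ * Q = 1 ∧ S.IsRectDiagonal ∧ (∀ i j, 0 ≤ S i j) ∧ M = Q * S := by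
  have hd := nonneg_of_gram_diagonal h
  have hM : ∀ i j, ∑ k, M k i * M k j = diagonal d i j := fun i j => congrFun (congrFun h i) j
  let v : Fin a → EuclideanSpace ℝ (Fin a) := fun i =>
    if hi : (i : ℕ) < b then WithLp.toLp 2 fun k => (√(d ⟨i, hi⟩))⁻¹ * M k ⟨i, hi⟩ else 0
  let s : Set (Fin a) := {i | ∃ hi : (i : ℕ) < b, d ⟨i, hi⟩ ≠ 0}
  have hv : Orthonormal ℝ (s.domRestrict v) := by
    rw [orthonormal_iff_ite]
    rintro ⟨i, hi, hdi⟩ ⟨j, hj, hdj⟩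
    have hs : 0 < √(d ⟨i, hi⟩) := Real.sqrt_pos.2 (lt_of_le_of_ne (hd _) hdi.symm)
    have e : inner ℝ (v i) (v j) = (√(d ⟨i, hi⟩))⁻¹ * (√(d ⟨j, hj⟩))⁻¹ *
        ∑ k, M k ⟨i, hi⟩ * M k ⟨j, hj⟩ := by
      simp only [v, hi, hj, dif_pos, PiLp.inner_apply, Finset.mul_sum]
      refine Finset.sum_congr rfl fun k _ => ?_
      simp
      ring
    rw [Set.domRestrict_apply, Set.domRestrict_apply, e, hM]
    by_cases hij : i = j
    · subst hij
      simp only [diagonal_apply_eq, if_true]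
      have := Real.mul_self_sqrt (hd ⟨i, hi⟩)
      field_simp
      nlinarith
    · rw [diagonal_apply_ne _ (by simpa [Fin.ext_iff] using hij), mul_zero,
        if_neg (by simpa using hij)]
  obtain ⟨w, hw⟩ := hv.exists_orthonormalBasis_extension_of_card_eq (by simp)
  refine ⟨Matrix.of fun i j => w j i,
    Matrix.of fun i j => if (i : ℕ) = j then √(d j) else 0, ?_, ?_, ?_, ?_⟩
  · ext i j
    have := orthonormal_iff_ite.1 w.orthonormal i j
    rw [PiLp.inner_apply] at this
    rw [one_apply, ← this, mul_apply]
    exact Finset.sum_congr rfl fun k _ => by simp [mul_comm]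
  · intro i j hij
    simp [hij]
  · intro i j
    rw [of_apply]
    split_ifs
    exacts [Real.sqrt_nonneg _, le_rfl]
  · ext i j
    rw [mul_apply, Finset.sum_eq_single (Fin.castLE hba j)]
    · by_cases hj : d j = 0
      · simp [hj, apply_eq_zero_of_gram_diagonal h hj]
      · have hs : 0 < √(d j) := Real.sqrt_pos.2 (lt_of_le_of_ne (hd _) (Ne.symm hj))
        have := hw (Fin.castLE hba j) ⟨j.2, hj⟩
        simp only [of_apply, this, v, Fin.val_castLE, j.2, dif_pos, if_true]
        field_simp
    · intro k _ hk
      have : (k : ℕ) ≠ j := fun e => hk (Fin.ext e)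
      simp [this]
    · simp

/-- Two symmetric matrices with product zero, nonnegative diagonals and diagonal difference
are both diagonal. -/
theorem Matrix.offDiag_eq_zero_of_mul_eq_zero {b : ℕ} {P Q : Matrix (Fin b) (Fin b) ℝ}
    {l : Fin b → ℝ} (hP : Pᵀ = P) (hQ : Qᵀ = Q) (hP0 : ∀ j, 0 ≤ P j j) (hQ0 : ∀ j, 0 ≤ Q j j)
    (hPQ : P * Q = 0) (hl : P - Q = diagonal l) {i j : Fin b} (hij : i ≠ j) :
    P i j = 0 ∧ Q i j = 0 := by
  have hQP : Q * P = 0 := by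
    have := congrArg transpose hPQ
    rwa [transpose_mul, hP, hQ, transpose_zero] at this
  have h0 : P i j - Q i j = 0 := by
    have := congrFun (congrFun hl i) j
    rwa [diagonal_apply_ne _ hij] at this
  have sq : ∀ (R : Matrix (Fin b) (Fin b) ℝ), Rᵀ = R → (R * R) j j ≤ 0 → R i j = 0 := by
    intro R hR hle
    have e : (R * R) j j = ∑ k, R k j * R k j := by
      rw [mul_apply]
      refine Finset.sum_congr rfl fun k _ => ?_
      rw [show R j k = R k j from congrFun (congrFun hR k) j]
    rw [e] at hle
    have := (Finset.single_le_sum (f := fun k => R k j * R k j)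
      (fun k _ => mul_self_nonneg _) (Finset.mem_univ i)).trans hle
    exact mul_self_eq_zero.1 (le_antisymm this (mul_self_nonneg _))
  rcases le_or_gt (l j) 0 with h | h
  · have e : P * P = P * diagonal l := by rw [← hl, mul_sub, hPQ, sub_zero]
    have := sq P hP (by
      rw [e, mul_diagonal]
      exact mul_nonpos_of_nonneg_of_nonpos (hP0 j) h)
    exact ⟨this, by linarith⟩
  · have e : Q * Q = -(Q * diagonal l) := by rw [← hl, mul_sub, hQP, zero_sub, neg_neg]
    have := sq Q hQ (by
      rw [e, neg_apply, mul_diagonal]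
      exact neg_nonpos.2 (mul_nonneg (hQ0 j) h.le))
    exact ⟨by linarith, this⟩

/-- If the row spaces of `G` and `K` are orthogonal, then a common orthogonal matrix makes the
columns of both pairwise orthogonal, with the nonzero columns of the first one leading. -/
theorem Matrix.exists_orthogonal_gram_diagonal {a b c : ℕ} (G : Matrix (Fin a) (Fin b) ℝ)
    (K : Matrix (Fin c) (Fin b) ℝ) (h : G * Kᵀ = 0) :
    ∃ (U : Matrix (Fin b) (Fin b) ℝ) (p q : Fin b → ℝ), Uᵀ * U = 1 ∧
      (G * U)ᵀ * (G * U) = diagonal p ∧ (K * U)ᵀ * (K * U) = diagonal q ∧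
      ∀ j, p j ≠ 0 ↔ (j : ℕ) < G.rank := by
  have hA : (Gᵀ * G - Kᵀ * K).IsHermitian := by
    simp [IsHermitian, conjTranspose_eq_transpose_of_trivial, transpose_sub, transpose_mul]
  let V : Matrix (Fin b) (Fin b) ℝ := hA.eigenvectorUnitary
  have hV : Vᵀ * V = 1 := by
    have := (mem_unitaryGroup_iff' (A := V)).1 hA.eigenvectorUnitary.2
    rwa [star_eq_conjTranspose, conjTranspose_eq_transpose_of_trivial] at this
  have hV' : V * Vᵀ = 1 := mul_eq_one_comm.1 hV
  have hspec : Vᵀ * (Gᵀ * G - Kᵀ * K) * V = diagonal hA.eigenvalues := by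
    have := hA.conjStarAlgAut_star_eigenvectorUnitary
    rwa [Unitary.conjStarAlgAut_star_apply, star_eq_conjTranspose,
      conjTranspose_eq_transpose_of_trivial] at this
  let P := (G * V)ᵀ * (G * V)
  let Q := (K * V)ᵀ * (K * V)
  have hoff : ∀ i j, i ≠ j → P i j = 0 ∧ Q i j = 0 := fun i j hij => by
    refine offDiag_eq_zero_of_mul_eq_zero (l := hA.eigenvalues)
      (by simp [transpose_mul, Matrix.mul_assoc]) (by simp [transpose_mul, Matrix.mul_assoc])
      (gram_apply_self_nonneg _) (gram_apply_self_nonneg _) ?_ ?_ hij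
    · calc P * Q = (G * V)ᵀ * (G * (V * Vᵀ) * Kᵀ) * (K * V) := by
            simp only [P, Q, transpose_mul, Matrix.mul_assoc]
        _ = 0 := by rw [hV', Matrix.mul_one, h, Matrix.mul_zero, Matrix.zero_mul]
    · rw [← hspec]
      simp only [transpose_mul, Matrix.mul_assoc, mul_sub, sub_mul]
  have hPd : P = diagonal fun j => P j j := by
    ext i j
    by_cases hij : i = j
    · subst hij; simp
    · rw [diagonal_apply_ne _ hij, (hoff i j hij).1]
  have hQd : Q = diagonal fun j => Q j j := by
    ext i j
    by_cases hij : i = j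
    · subst hij; simp
    · rw [diagonal_apply_ne _ hij, (hoff i j hij).2]
  have hrank : Fintype.card {j // P j j ≠ 0} = G.rank := by
    rw [← rank_diagonal, ← hPd, rank_transpose_mul_self]
    exact rank_mul_eq_left_of_isUnit_det _ _
      ((isUnit_iff_isUnit_det _).1 (IsUnit.of_mul_eq_one _ hV'))
  have hcard : Fintype.card {j : Fin b // (j : ℕ) < G.rank} = Fintype.card {j // P j j ≠ 0} := by
    rw [hrank, Fintype.card_subtype, Fin.card_filter_val_lt, min_eq_right]
    simpa using G.rank_le_width
  let e := Fintype.equivOfCardEq hcard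
  let τ : Equiv.Perm (Fin b) := e.extendSubtype
  have hperm : ∀ {e : ℕ} (M : Matrix (Fin e) (Fin b) ℝ) (f : Fin b → ℝ),
      (M * V)ᵀ * (M * V) = diagonal f →
      (M * V.submatrix id τ)ᵀ * (M * V.submatrix id τ) = diagonal (f ∘ τ) := by
    intro e M f hf
    rw [← submatrix_diagonal_equiv, ← hf]
    rfl
  refine ⟨V.submatrix id τ, fun j => P (τ j) (τ j), fun j => Q (τ j) (τ j), ?_, ?_, ?_, ?_⟩
  · rw [← submatrix_one_equiv τ, ← hV]
    rfl
  · exact hperm G _ hPd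
  · exact hperm K _ hQd
  · intro j
    constructor
    · intro hj
      by_contra hlt
      exact e.extendSubtype_not_mem j hlt hj
    · exact fun hj => e.extendSubtype_mem j hj

/-- **Characterization of equilibria of the two-layer gradient flow via simultaneous SVDs.**
For `K₁ ∈ ℝ^{κ×n}`, `K₂ ∈ ℝ^{m×κ}`, `G ∈ ℝ^{m×n}` with `κ ≥ m` and `κ ≥ n`, the conditions
`K₂ᵀG = 0` and `GK₁ᵀ = 0` hold iff there are SVDs `G = ΨΣΦᵀ`, `K₁ = Γ₁Σ₁Φᵀ`, `K₂ = ΨΣ₂Γ₂ᵀ`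
with `Σ·Σ₁ᵀ = 0` and `Σ₂ᵀ·Σ = 0`. -/
theorem two_layer_equilibrium_svd {m n κ : ℕ}
    (hm : 0 < m) (hn : 0 < n) (hκ : 0 < κ) (hκm : m ≤ κ) (hκn : n ≤ κ)
    (K₁ : Matrix (Fin κ) (Fin n) ℝ) (K₂ : Matrix (Fin m) (Fin κ) ℝ)
    (G : Matrix (Fin m) (Fin n) ℝ) :
    (K₂ᵀ * G = 0 ∧ G * K₁ᵀ = 0) ↔
      ∃ (Psi : Matrix (Fin m) (Fin m) ℝ) (Phi : Matrix (Fin n) (Fin n) ℝ)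
        (Γ₁ Γ₂ : Matrix (Fin κ) (Fin κ) ℝ)
        (S : Matrix (Fin m) (Fin n) ℝ)
        (S₁ : Matrix (Fin κ) (Fin n) ℝ) (S₂ : Matrix (Fin m) (Fin κ) ℝ),
        Psiᵀ * Psi = 1 ∧ Phiᵀ * Phi = 1 ∧ Γ₁ᵀ * Γ₁ = 1 ∧ Γ₂ᵀ * Γ₂ = 1 ∧
        S.IsRectDiagonal ∧ (∀ i j, 0 ≤ S i j) ∧
        S₁.IsRectDiagonal ∧ (∀ i j, 0 ≤ S₁ i j) ∧
        S₂.IsRectDiagonal ∧ (∀ i j, 0 ≤ S₂ i j) ∧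
        G = Psi * S * Phiᵀ ∧ K₁ = Γ₁ * S₁ * Phiᵀ ∧ K₂ = Psi * S₂ * Γ₂ᵀ ∧
        S * S₁ᵀ = 0 ∧ S₂ᵀ * S = 0 := by
  constructor
  · rintro ⟨h2, h1⟩
    have h2' : Gᵀ * K₂ᵀᵀ = 0 := by
      rw [← transpose_mul, h2, transpose_zero]
    obtain ⟨U, p, q, hU, hp, hq, hpr⟩ := exists_orthogonal_gram_diagonal G K₁ h1
    obtain ⟨W, p', q', hW, hp', hq', hpr'⟩ := exists_orthogonal_gram_diagonal Gᵀ K₂ᵀ h2'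
    rw [rank_transpose] at hpr'
    have hU' : U * Uᵀ = 1 := mul_eq_one_comm.1 hU
    have hrn : G.rank ≤ n := by simpa using G.rank_le_width
    have hp0 := nonneg_of_gram_diagonal hp
    have hs0 : ∀ j : Fin n, (j : ℕ) < G.rank → 0 < √(p j) := fun j hj =>
      Real.sqrt_pos.2 (lt_of_le_of_ne (hp0 j) ((hpr j).2 hj).symm)
    have hN : ∀ i j, ∑ k, (G * U) k i * (G * U) k j = diagonal p i j :=
      fun i j => congrFun (congrFun hp i) j
    have hWW : ∀ i j, ∑ k, W k i * W k j = (1 : Matrix (Fin m) (Fin m) ℝ) i j :=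
      fun i j => congrFun (congrFun hW i) j
    let Psi : Matrix (Fin m) (Fin m) ℝ := Matrix.of fun i j =>
      if h : (j : ℕ) < G.rank then (√(p ⟨j, h.trans_le hrn⟩))⁻¹ * (G * U) i ⟨j, h.trans_le hrn⟩
      else W i j
    have hPlt : ∀ i j (h : ((j : Fin m) : ℕ) < G.rank),
        Psi i j = (√(p ⟨j, h.trans_le hrn⟩))⁻¹ * (G * U) i ⟨j, h.trans_le hrn⟩ :=
      fun i j h => dif_pos h
    have hPge : ∀ i j, ¬ ((j : Fin m) : ℕ) < G.rank → Psi i j = W i j :=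
      fun i j h => dif_neg h
    have hWN : ∀ (i : Fin m) (j : Fin n), ¬ (i : ℕ) < G.rank →
        ∑ k, W k i * (G * U) k j = 0 := by
      intro i j hi
      have hz : ∀ k, (Gᵀ * W) k i = 0 :=
        apply_eq_zero_of_gram_diagonal hp' (not_not.1 fun h => hi ((hpr' i).1 h))
      have e : ∑ k, W k i * (G * U) k j = ((Gᵀ * W)ᵀ * U) i j := by
        rw [transpose_mul, transpose_transpose, Matrix.mul_assoc]; rfl
      rw [e, mul_apply]
      exact Finset.sum_eq_zero fun k _ => by rw [transpose_apply, hz, zero_mul]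
    let S : Matrix (Fin m) (Fin n) ℝ := Matrix.of fun i j => if (i : ℕ) = j then √(p j) else 0
    have hPN : Psiᵀ * (G * U) = S := by
      ext i j
      rw [mul_apply]
      simp only [transpose_apply, S, of_apply]
      by_cases hi : (i : ℕ) < G.rank
      · have hs := hs0 ⟨i, hi.trans_le hrn⟩ hi
        simp only [hPlt _ i hi, mul_assoc]
        rw [← Finset.mul_sum, hN]
        by_cases hij : (i : ℕ) = j
        · obtain rfl : j = ⟨i, hi.trans_le hrn⟩ := Fin.ext hij.symm
          rw [diagonal_apply_eq, if_pos rfl, inv_mul_eq_iff_eq_mul₀ hs.ne',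
            Real.mul_self_sqrt (hp0 _)]
        · rw [if_neg hij, diagonal_apply_ne _ (fun h => hij (congrArg Fin.val h)), mul_zero]
      · simp only [hPge _ i hi]
        rw [hWN i j hi]
        split_ifs with hij
        · have : p j = 0 := not_not.1 fun h => hi (hij ▸ (hpr j).1 h)
          rw [this, Real.sqrt_zero]
        · rfl
    have hPsi : Psiᵀ * Psi = 1 := by
      have key : ∀ (i j : Fin m), (j : ℕ) < G.rank → (Psiᵀ * Psi) i j = (1 : Matrix _ _ ℝ) i j := by
        intro i j hj
        have hs := hs0 ⟨j, hj.trans_le hrn⟩ hj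
        have e : (Psiᵀ * Psi) i j = (√(p ⟨j, hj.trans_le hrn⟩))⁻¹ *
            (Psiᵀ * (G * U)) i ⟨j, hj.trans_le hrn⟩ := by
          rw [mul_apply, mul_apply, Finset.mul_sum]
          exact Finset.sum_congr rfl fun k _ => by rw [hPlt k j hj]; ring
        rw [e, hPN, one_apply]
        simp only [S, of_apply, Fin.ext_iff]
        split_ifs
        · exact inv_mul_cancel₀ hs.ne'
        · exact mul_zero _
      ext i j
      by_cases hj : (j : ℕ) < G.rank
      · exact key i j hj
      by_cases hi : (i : ℕ) < G.rank
      · have e : (Psiᵀ * Psi) i j = (Psiᵀ * Psi) j i := by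
          simp only [mul_apply, transpose_apply, mul_comm]
        rw [e, key j i hi, one_apply, one_apply]
        simp only [eq_comm]
      · rw [mul_apply]
        simp only [transpose_apply, hPge _ i hi, hPge _ j hj]
        exact hWW i j
    have hPsi' : Psi * Psiᵀ = 1 := mul_eq_one_comm.1 hPsi
    have hKlt : ∀ (k : Fin κ) (j : Fin m), (j : ℕ) < G.rank → (K₂ᵀ * Psi) k j = 0 := by
      intro k j hj
      have e : (K₂ᵀ * Psi) k j = (√(p ⟨j, hj.trans_le hrn⟩))⁻¹ *
          (K₂ᵀ * (G * U)) k ⟨j, hj.trans_le hrn⟩ := by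
        rw [mul_apply, mul_apply, Finset.mul_sum]
        exact Finset.sum_congr rfl fun k _ => by rw [hPlt k j hj]; ring
      rw [e, ← Matrix.mul_assoc, h2, Matrix.zero_mul, Matrix.zero_apply, mul_zero]
    have hKge : ∀ (k : Fin κ) (j : Fin m), ¬ (j : ℕ) < G.rank →
        (K₂ᵀ * Psi) k j = (K₂ᵀ * W) k j := by
      intro k j hj
      simp only [mul_apply, hPge _ j hj]
    have hK : (K₂ᵀ * Psi)ᵀ * (K₂ᵀ * Psi) =
        diagonal fun j : Fin m => if (j : ℕ) < G.rank then 0 else q' j := by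
      ext i j
      rw [mul_apply]
      simp only [transpose_apply]
      by_cases hi : (i : ℕ) < G.rank
      · rw [Finset.sum_eq_zero fun k _ => by rw [hKlt k i hi, zero_mul], diagonal_apply]
        simp [hi]
      by_cases hj : (j : ℕ) < G.rank
      · rw [Finset.sum_eq_zero fun k _ => by rw [hKlt k j hj, mul_zero], diagonal_apply_ne]
        rintro rfl
        exact hi hj
      · simp only [hKge _ i hi, hKge _ j hj]
        have := congrFun (congrFun hq' i) j
        rw [mul_apply] at this
        simp only [transpose_apply] at this
        rw [this, diagonal_apply, diagonal_apply, if_neg hi]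
    obtain ⟨Γ₁, S₁, hΓ₁, hS₁, hS₁0, e₁⟩ := exists_orthogonal_mul_rectDiagonal hκn hq
    obtain ⟨Γ₂, S₂, hΓ₂, hS₂, hS₂0, e₂⟩ := exists_orthogonal_mul_rectDiagonal hκm hK
    have f₁ : S₁ = Γ₁ᵀ * (K₁ * U) := by rw [e₁, ← Matrix.mul_assoc, hΓ₁, Matrix.one_mul]
    have f₂ : S₂ = Γ₂ᵀ * (K₂ᵀ * Psi) := by rw [e₂, ← Matrix.mul_assoc, hΓ₂, Matrix.one_mul]
    refine ⟨Psi, U, Γ₁, Γ₂, S, S₁, S₂ᵀ, hPsi, hU, hΓ₁, hΓ₂, ?_, ?_, hS₁, hS₁0,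
      fun i j hij => hS₂ j i hij.symm, fun i j => hS₂0 j i, ?_, ?_, ?_, ?_, ?_⟩
    · exact fun i j hij => if_neg hij
    · intro i j
      simp only [S, of_apply]
      split_ifs
      exacts [Real.sqrt_nonneg _, le_rfl]
    · rw [← hPN, ← Matrix.mul_assoc, hPsi', Matrix.one_mul, Matrix.mul_assoc, hU', Matrix.mul_one]
    · rw [← e₁, Matrix.mul_assoc, hU', Matrix.mul_one]
    · rw [Matrix.mul_assoc, ← transpose_mul Γ₂ S₂, ← e₂, transpose_mul, transpose_transpose,
        ← Matrix.mul_assoc, hPsi', Matrix.one_mul]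
    · calc S * S₁ᵀ = Psiᵀ * (G * (U * Uᵀ) * K₁ᵀ) * Γ₁ := by
            rw [← hPN, f₁]
            simp only [transpose_mul, transpose_transpose, Matrix.mul_assoc]
        _ = 0 := by rw [hU', Matrix.mul_one, h1, Matrix.mul_zero, Matrix.zero_mul]
    · calc S₂ᵀᵀ * S = Γ₂ᵀ * (K₂ᵀ * (Psi * Psiᵀ) * G) * U := by
            rw [← hPN, f₂]
            simp only [transpose_transpose, Matrix.mul_assoc]
        _ = 0 := by rw [hPsi', Matrix.mul_one, h2, Matrix.mul_zero, Matrix.zero_mul]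
  · rintro ⟨Psi, Phi, Γ₁, Γ₂, S, S₁, S₂, hPsi, hPhi, -, -, -, -, -, -, -, -, rfl, rfl, rfl, h1, h2⟩
    constructor
    · calc (Psi * S₂ * Γ₂ᵀ)ᵀ * (Psi * S * Phiᵀ) = Γ₂ * (S₂ᵀ * (Psiᵀ * Psi) * S) * Phiᵀ := by
            simp only [transpose_mul, transpose_transpose, Matrix.mul_assoc]
        _ = 0 := by rw [hPsi, Matrix.mul_one, h2, Matrix.mul_zero, Matrix.zero_mul]
    · calc Psi * S * Phiᵀ * (Γ₁ * S₁ * Phiᵀ)ᵀ = Psi * (S * (Phiᵀ * Phi) * S₁ᵀ) * Γ₁ᵀ := by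
            simp only [transpose_mul, transpose_transpose, Matrix.mul_assoc]
        _ = 0 := by rw [hPhi, Matrix.mul_one, h1, Matrix.mul_zero, Matrix.zero_mul]
end

section
/- Fix real numbers a, q, r with a < 0, q > 0, r > 0, and an integer κ ≥ 1. Define f(k₁,k₂) := -(r⟨k₂,k₁⟩² + 2ar⟨k₂,k₁⟩ - q)/(2(a + ⟨k₂,k₁⟩)²) on 𝒦 := {(k₁,k₂) ∈ ℝ^κ × ℝ^κ : a + ⟨k₂,k₁⟩ < 0}, and let k₋* := -a - √(a² + q/r). Let k₁, k₂ : [0,∞) → ℝ^κ be differentiable with (k₁(t),k₂(t)) ∈ 𝒦 for all t, satisfying k₁' = -f(k₁,k₂)·k₂ and k₂' = -f(k₁,k₂)·k₁, and suppose (k₁(t),k₂(t)) converges as t → ∞ to a point (k̄₁,k̄₂) ∈ 𝒦 that is an equilibrium of this dynamics (i.e., f(k̄₁,k̄₂)·k̄₂ = 0 and f(k̄₁,k̄₂)·k̄₁ = 0). Then ⟨k̄₂,k̄₁⟩ = k₋* if and only if ‖k₁(0) - k₂(0)‖ > 0. -/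
open Set Filter
open scoped RealInnerProductSpace

/-- A solution on `[0, ∞)` of the linear equation `u' = g • u` with continuous scalar coefficient
is the initial value times the exponential of the integral of `g`. -/
theorem eq_exp_integral_smul_of_hasDerivWithinAt {E : Type*} [NormedAddCommGroup E]
    [NormedSpace ℝ E] {g : ℝ → ℝ} (hg : Continuous g) {u : ℝ → E}
    (hu : ∀ t ∈ Ici (0 : ℝ), HasDerivWithinAt u (g t • u t) (Ici 0) t) {t : ℝ} (ht : 0 ≤ t) :
    u t = Real.exp (∫ s in (0 : ℝ)..t, g s) • u 0 := by
  have hG (x : ℝ) : HasDerivAt (fun x => ∫ s in (0 : ℝ)..x, g s) (g x) x :=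
    hg.integral_hasStrictDerivAt 0 x |>.hasDerivAt
  have hw (x : ℝ) (hx : x ∈ Ici (0 : ℝ)) :
      HasDerivWithinAt (fun x => Real.exp (-∫ s in (0 : ℝ)..x, g s) • u x) 0 (Ici 0) x := by
    refine ((hG x).neg.exp.hasDerivWithinAt.smul (hu x hx)).congr_deriv ?_
    simp only [smul_smul, ← add_smul]
    convert zero_smul ℝ (u x) using 2
    simp only [Pi.neg_apply]
    ring
  have hconst := (convex_Ici (0 : ℝ)).norm_image_sub_le_of_norm_hasDerivWithin_le
    (C := 0) hw (by simp) self_mem_Ici ht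
  simp only [zero_mul, norm_le_zero_iff, sub_eq_zero, intervalIntegral.integral_same, neg_zero,
    Real.exp_zero, one_smul] at hconst
  rw [← hconst, smul_smul, ← Real.exp_add, add_neg_cancel, Real.exp_zero, one_smul]

/-- A solution on `[0, ∞)` of `u' = g • u` that tends to `0` while the continuous scalar
coefficient is eventually nonnegative starts at `0`. -/
theorem eq_zero_of_hasDerivWithinAt_smul_of_tendsto_zero {E : Type*} [NormedAddCommGroup E]
    [NormedSpace ℝ E] {g : ℝ → ℝ} (hg : Continuous g) {u : ℝ → E}
    (hu : ∀ t ∈ Ici (0 : ℝ), HasDerivWithinAt u (g t • u t) (Ici 0) t)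
    (hpos : ∀ᶠ t in atTop, 0 ≤ g t) (hlim : Tendsto u atTop (nhds 0)) : u 0 = 0 := by
  obtain ⟨T, hT⟩ := eventually_atTop.1 hpos
  have hle : ∀ᶠ t in atTop, Real.exp (∫ s in (0 : ℝ)..T, g s) * ‖u 0‖ ≤ ‖u t‖ := by
    filter_upwards [eventually_ge_atTop T, eventually_ge_atTop 0] with t hTt ht
    rw [eq_exp_integral_smul_of_hasDerivWithinAt hg hu ht, norm_smul, Real.norm_eq_abs,
      Real.abs_exp, ← intervalIntegral.integral_add_adjacent_intervals
        (hg.intervalIntegrable 0 T) (hg.intervalIntegrable T t)]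
    have := intervalIntegral.integral_nonneg (μ := MeasureTheory.volume) hTt
      (fun x hx => hT x hx.1)
    gcongr
    linarith
  have h := ge_of_tendsto hlim.norm hle
  rw [norm_zero] at h
  exact norm_le_zero_iff.1 (nonpos_of_mul_nonpos_right h (Real.exp_pos _))

/-- In the stabilizing region `a + s < 0`, the only root of `r s² + 2 a r s - q` is
`-a - √(a² + q / r)`. -/
theorem eq_neg_sub_sqrt_iff_of_add_neg {a q r s : ℝ} (hr : 0 < r) (hs : a + s < 0) :
    s = -a - Real.sqrt (a ^ 2 + q / r) ↔ r * s ^ 2 + 2 * a * r * s - q = 0 := by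
  have key : s = -a - Real.sqrt (a ^ 2 + q / r) ↔ Real.sqrt (a ^ 2 + q / r) = -(a + s) := by
    constructor <;> intro h <;> linarith
  rw [key, Real.sqrt_eq_iff_mul_self_eq_of_pos (by linarith)]
  field_simp
  constructor <;> intro h <;> linarith

/-- **Convergence dichotomy for the vector-case gradient flow.**
With `a < 0`, a solution of `k₁' = -f·k₂`, `k₂' = -f·k₁` on `[0,∞)` staying in the
stabilizing set and converging to an equilibrium `(k̄₁,k̄₂)` of the flow reaches the optimal
gain, `⟪k̄₂,k̄₁⟫ = k₋* = -a - √(a² + q/r)`, if and only if `‖k₁(0) - k₂(0)‖ > 0`. -/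
theorem vector_case_convergence_dichotomy (a q r : ℝ)
    (ha : a < 0) (hq : 0 < q) (hr : 0 < r)
    (κ : ℕ) (hκ : 1 ≤ κ)
    (f : EuclideanSpace ℝ (Fin κ) → EuclideanSpace ℝ (Fin κ) → ℝ)
    (hf : ∀ k₁ k₂, f k₁ k₂
      = -(r * ⟪k₂, k₁⟫ ^ 2 + 2 * a * r * ⟪k₂, k₁⟫ - q) / (2 * (a + ⟪k₂, k₁⟫) ^ 2))
    (kstar : ℝ) (hkstar : kstar = -a - Real.sqrt (a ^ 2 + q / r))
    (k₁ k₂ : ℝ → EuclideanSpace ℝ (Fin κ))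
    (hstab : ∀ t ∈ Ici (0 : ℝ), a + ⟪k₂ t, k₁ t⟫ < 0)
    (hflow₁ : ∀ t ∈ Ici (0 : ℝ),
      HasDerivWithinAt k₁ (-(f (k₁ t) (k₂ t)) • k₂ t) (Ici 0) t)
    (hflow₂ : ∀ t ∈ Ici (0 : ℝ),
      HasDerivWithinAt k₂ (-(f (k₁ t) (k₂ t)) • k₁ t) (Ici 0) t)
    (kbar₁ kbar₂ : EuclideanSpace ℝ (Fin κ))
    (hlim : Tendsto (fun t => (k₁ t, k₂ t)) atTop (nhds (kbar₁, kbar₂)))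
    (hbar_stab : a + ⟪kbar₂, kbar₁⟫ < 0)
    (heq₁ : f kbar₁ kbar₂ • kbar₂ = 0) (heq₂ : f kbar₁ kbar₂ • kbar₁ = 0) :
    ⟪kbar₂, kbar₁⟫ = kstar ↔ 0 < ‖k₁ 0 - k₂ 0‖ := by
  have hf_cont : ContinuousOn (fun t => f (k₁ t) (k₂ t)) (Ici 0) := by
    have h₁ : ContinuousOn k₁ (Ici 0) := fun t ht => (hflow₁ t ht).continuousWithinAt
    have h₂ : ContinuousOn k₂ (Ici 0) := fun t ht => (hflow₂ t ht).continuousWithinAt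
    simp only [hf]
    refine ContinuousOn.div (by fun_prop) (by fun_prop) fun t ht => ?_
    have := (hstab t ht).ne
    positivity
  have hg : Continuous fun t : ℝ => f (k₁ (max t 0)) (k₂ (max t 0)) :=
    hf_cont.comp_continuous (f := fun t : ℝ => max t 0) (by fun_prop) fun t => le_max_right t 0
  have hu : ∀ t ∈ Ici (0 : ℝ), HasDerivWithinAt (fun t => k₁ t - k₂ t)
      (f (k₁ (max t 0)) (k₂ (max t 0)) • (k₁ t - k₂ t)) (Ici 0) t := fun t ht => by
    refine ((hflow₁ t ht).sub (hflow₂ t ht)).congr_deriv ?_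
    rw [max_eq_left ht]
    module
  have hlim₁ : Tendsto k₁ atTop (nhds kbar₁) := hlim.fst_nhds
  have hlim₂ : Tendsto k₂ atTop (nhds kbar₂) := hlim.snd_nhds
  have hlim_u := hlim₁.sub hlim₂
  rw [hkstar, eq_neg_sub_sqrt_iff_of_add_neg hr hbar_stab, norm_pos_iff]
  constructor
  · intro hroot h0
    have hzero : Tendsto (fun t => k₁ t - k₂ t) atTop (nhds 0) := by
      refine tendsto_const_nhds.congr' ?_
      filter_upwards [eventually_ge_atTop 0] with t ht
      rw [eq_exp_integral_smul_of_hasDerivWithinAt hg hu ht, h0, smul_zero]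
    have hbar : kbar₁ = kbar₂ := sub_eq_zero.1 (tendsto_nhds_unique hlim_u hzero)
    have hs : 0 ≤ ⟪kbar₂, kbar₁⟫ := hbar ▸ real_inner_self_nonneg
    nlinarith [mul_nonneg hr.le hs]
  · intro h0
    by_contra hroot
    have hfbar : f kbar₁ kbar₂ ≠ 0 := by
      rw [hf]
      exact div_ne_zero (neg_ne_zero.2 hroot) (by have := hbar_stab.ne; positivity)
    have hk₁ : kbar₁ = 0 := (smul_eq_zero.1 heq₂).resolve_left hfbar
    have hk₂ : kbar₂ = 0 := (smul_eq_zero.1 heq₁).resolve_left hfbar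
    subst hk₁ hk₂
    refine h0 (eq_zero_of_hasDerivWithinAt_smul_of_tendsto_zero hg hu ?_ (by simpa using hlim_u))
    have hs : Tendsto (fun t => r * ⟪k₂ t, k₁ t⟫ ^ 2 + 2 * a * r * ⟪k₂ t, k₁ t⟫ - q) atTop
        (nhds (-q)) := by
      have hi := hlim₂.inner (𝕜 := ℝ) hlim₁
      simpa using (((hi.pow 2).const_mul r).add (hi.const_mul (2 * a * r))).sub_const q
    filter_upwards [hs.eventually_lt_const (neg_lt_zero.2 hq), eventually_ge_atTop 0] with t h ht
    rw [max_eq_left ht, hf]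
    exact div_nonneg (neg_nonneg.2 h.le) (by positivity)
end
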